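/- Let g = g_{-1}⊕g_0⊕g_1 be a |1|-graded simple Lie algebra with Killing-dual bases as in the setting (e_i, E, A_j, ε^i) ↔ (ε^i, E/(2d), A_j^*, e_i). Let ρ_* be a representation of g_0 on a vector space U and define C^♭ = −(1/2)ρ_*(E) + (1/(2d))ρ_*(E)² + ∑_j ρ_*(A_j)ρ_*(A_j^*) on U, and γ: g_1 → Hom(U, U') intertwining operators satisfying the commutation rules α_*(A)∘γ(h) − γ(h)∘α_*(A) = γ([A,h]) for all A ∈ g_0, h ∈ g_1 (where α_* denotes the relevant g_0-actions on U and U'). Then C^♭ ∘ γ(h) − γ(h) ∘ C^♭ = γ( (−(1/2)ad(E) + (1/(2d))ad(E)² + ∑_j ad(A_j)ad(A_j^*)) h ) + (1/d)γ([E,h])ρ_*(E) + ∑_j ( γ([A_j,h])ρ_*(A_j^*) + γ([A_j^*,h])ρ_*(A_j) ), and the first term vanishes since the adjoint Casimir is the identity and [E,h] = h; hence C^♭∘γ(h) − γ(h)∘C^♭ = 2∑_i γ(ε^i) ρ_*([h,e_i]). -/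

import Mathlib

/-- A vector in the span of `v` is recovered from its pairings with a family dual to `v`. -/
theorem sum_dual_smul_eq_of_mem_span {R M ι : Type*} [CommRing R] [AddCommGroup M] [Module R M]
    [Fintype ι] [DecidableEq ι] (B : M →ₗ[R] M →ₗ[R] R) (v w : ι → M)
    (hdual : ∀ i j, B (w i) (v j) = if i = j then 1 else 0)
    {y : M} (hy : y ∈ Submodule.span R (Set.range v)) :
    ∑ i, B (w i) y • v i = y := by
  induction hy using Submodule.span_induction with
  | mem x hx => obtain ⟨j, rfl⟩ := hx; simp [hdual]
  | zero => simp
  | add x y _ _ hx hy => simp only [map_add, add_smul, Finset.sum_add_distrib, hx, hy]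
  | smul c x _ hx => simp only [map_smul, smul_eq_mul, mul_smul, ← Finset.smul_sum, hx]

/-- The trace computed in a family with given coordinate functionals. -/
theorem trace_eq_sum_coord {R M ι : Type*} [CommRing R] [AddCommGroup M] [Module R M]
    [Module.Free R M] [Module.Finite R M] [Fintype ι] (x : ι → M) (f : ι → Module.Dual R M)
    (hdec : ∀ y, ∑ i, f i y • x i = y) (φ : Module.End R M) :
    LinearMap.trace R M φ = ∑ i, f i (φ (x i)) := by
  have hφ : φ = ∑ i, (f i).smulRight (φ (x i)) := by
    ext y
    conv_lhs => rw [← hdec y]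
    simp
  conv_lhs => rw [hφ]
  simp

section KillingDual

variable {L : Type*} [LieRing L] [LieAlgebra ℝ L]

theorem killingForm_lie_left (x y z : L) :
    killingForm ℝ L ⁅x, y⁆ z = killingForm ℝ L x ⁅y, z⁆ :=
  LieModule.traceForm_apply_lie_apply ℝ L L x y z

theorem killingForm_symm (x y : L) : killingForm ℝ L x y = killingForm ℝ L y x :=
  LieModule.traceForm_comm ℝ L L x y

/-- Eigenvectors of `ad E` are Killing-orthogonal unless their eigenvalues are opposite. -/
theorem killingForm_eq_zero_of_eigen {E x y : L} {a b : ℝ} (hx : ⁅E, x⁆ = a • x)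
    (hy : ⁅E, y⁆ = b • y) (hab : a + b ≠ 0) : killingForm ℝ L x y = 0 := by
  have h := killingForm_lie_left x E y
  rw [← lie_skew, hx, hy] at h
  simp only [map_neg, map_smul, LinearMap.neg_apply, LinearMap.smul_apply, smul_eq_mul] at h
  have h' : (a + b) * killingForm ℝ L x y = 0 := by linarith
  exact (mul_eq_zero.mp h').resolve_left hab

variable {ι : Type*} [Fintype ι] {x x' : ι → L}

theorem eq_of_killingForm_eq (hdec : ∀ y, ∑ i, killingForm ℝ L (x' i) y • x i = y) {y z : L}
    (h : ∀ w, killingForm ℝ L y w = killingForm ℝ L z w) : y = z := by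
  rw [← hdec y, ← hdec z]
  simp only [killingForm_symm (x' _), h]

variable [Module.Finite ℝ L]

theorem killingForm_eq_sum (hdec : ∀ y, ∑ i, killingForm ℝ L (x' i) y • x i = y) (u v : L) :
    killingForm ℝ L u v = ∑ i, killingForm ℝ L (x' i) ⁅u, ⁅v, x i⁆⁆ := by
  have h := trace_eq_sum_coord x (fun i => killingForm ℝ L (x' i)) hdec
    (LieAlgebra.ad ℝ L u ∘ₗ LieAlgebra.ad ℝ L v)
  simpa [killingForm_apply_apply] using h

/-- The Casimir element of the Killing form acts as the identity in the adjoint representation. -/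
theorem casimir_ad_eq_id (hdec : ∀ y, ∑ i, killingForm ℝ L (x' i) y • x i = y) (y : L) :
    ∑ i, ⁅x i, ⁅x' i, y⁆⁆ = y := by
  refine eq_of_killingForm_eq hdec fun z => ?_
  rw [killingForm_eq_sum hdec y z, map_sum, LinearMap.sum_apply]
  refine Finset.sum_congr rfl fun i _ => ?_
  rw [← killingForm_lie_left (x' i) y, ← lie_skew (x i), map_neg, LinearMap.neg_apply,
    killingForm_lie_left, ← lie_skew z, map_neg]

end KillingDual

/-- Commutation of the flat Casimir-like operator
`C♭ = −(1/2)ρ⋆(E) + (1/(2d))ρ⋆(E)² + ∑ⱼ ρ⋆(Aⱼ)ρ⋆(Aⱼ*)` with an intertwining family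
`γ(h)` (`h ∈ g₁`) satisfying `ρ⋆'(A)∘γ(h) − γ(h)∘ρ⋆(A) = γ(⁅A,h⁆)` :
`C♭' ∘ γ(h) − γ(h) ∘ C♭ = 2 ∑ᵢ γ(εⁱ) ∘ ρ⋆(⁅h, eᵢ⁆)`. -/
theorem flat_casimir_commutator_with_gamma
    {L : Type*} [LieRing L] [LieAlgebra ℝ L] [LieAlgebra.IsSimple ℝ L]
    [Module.Finite ℝ L]
    (gm g0 g1 h0 : Submodule ℝ L)
    (hsup : gm ⊔ g0 ⊔ g1 = ⊤)
    (hind : ∀ x ∈ gm, ∀ y ∈ g0, ∀ z ∈ g1, x + y + z = 0 → x = 0 ∧ y = 0 ∧ z = 0)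
    (hmm : ∀ x ∈ gm, ∀ y ∈ gm, ⁅x, y⁆ = 0)
    (hm0 : ∀ x ∈ gm, ∀ y ∈ g0, ⁅x, y⁆ ∈ gm)
    (hm1 : ∀ x ∈ gm, ∀ y ∈ g1, ⁅x, y⁆ ∈ g0)
    (h00 : ∀ x ∈ g0, ∀ y ∈ g0, ⁅x, y⁆ ∈ g0)
    (h01 : ∀ x ∈ g0, ∀ y ∈ g1, ⁅x, y⁆ ∈ g1)
    (h11 : ∀ x ∈ g1, ∀ y ∈ g1, ⁅x, y⁆ = 0)
    -- grading element `E`, with `g₀ = h₀ ⊕ ℝ E`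
    (E : L) (hE : E ∈ g0)
    (hEm : ∀ x ∈ gm, ⁅E, x⁆ = -x)
    (hE0 : ∀ x ∈ g0, ⁅E, x⁆ = 0)
    (hE1 : ∀ x ∈ g1, ⁅E, x⁆ = x)
    (hg0 : g0 = h0 ⊔ Submodule.span ℝ {E})
    (hEh0 : E ∉ h0)
    -- Killing-dual bases `(eᵢ, E, Aⱼ, εⁱ)` and `(εⁱ, E/(2d), Aⱼ*, eᵢ)`
    (d n : ℕ) (e ε : Fin d → L) (A As : Fin n → L)
    (he : ∀ i, e i ∈ gm) (hε : ∀ i, ε i ∈ g1)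
    (hA : ∀ j, A j ∈ h0) (hAs : ∀ j, As j ∈ h0)
    (hspan_e : Submodule.span ℝ (Set.range e) = gm)
    (hspan_ε : Submodule.span ℝ (Set.range ε) = g1)
    (hspan_A : Submodule.span ℝ (Set.range A) = h0)
    (hspan_As : Submodule.span ℝ (Set.range As) = h0)
    (hdual_eε : ∀ i j, killingForm ℝ L (ε i) (e j) = if i = j then 1 else 0)
    (hdual_AAs : ∀ j k, killingForm ℝ L (As j) (A k) = if j = k then 1 else 0)
    (hKEE : killingForm ℝ L E E = 2 * (d : ℝ))
    (hKEA : ∀ j, killingForm ℝ L E (A j) = 0)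
    (hKEAs : ∀ j, killingForm ℝ L E (As j) = 0)
    -- structure constants of `ad(Aⱼ)` and `ad(Aⱼ*)` on `g₋₁`:
    -- `⁅Aⱼ, eᵢ⁆ = ∑ᵣ a j r i • e r`, `⁅Aⱼ*, eᵢ⁆ = ∑ᵣ as j r i • e r`
    (a as : Fin n → Fin d → Fin d → ℝ)
    (ha : ∀ j i, ⁅A j, e i⁆ = ∑ r, a j r i • e r)
    (has : ∀ j i, ⁅As j, e i⁆ = ∑ r, as j r i • e r)
    -- a representation `ρ⋆` of `g₀` on `U`, a representation `ρ⋆'` of `g₀` on `U'`,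
    {U U' : Type*} [AddCommGroup U] [Module ℝ U] [AddCommGroup U'] [Module ℝ U']
    (ρU : L →ₗ[ℝ] Module.End ℝ U) (ρU' : L →ₗ[ℝ] Module.End ℝ U')
    (hρU : ∀ x ∈ g0, ∀ y ∈ g0, ρU ⁅x, y⁆ = ⁅ρU x, ρU y⁆)
    (hρU' : ∀ x ∈ g0, ∀ y ∈ g0, ρU' ⁅x, y⁆ = ⁅ρU' x, ρU' y⁆)
    -- a family of operators `γ(h) : U → U'`, `h ∈ g₁`, linear in `h`,
    (γ : L → (U →ₗ[ℝ] U'))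
    (hγadd : ∀ h ∈ g1, ∀ h' ∈ g1, γ (h + h') = γ h + γ h')
    (hγsmul : ∀ (c : ℝ), ∀ h ∈ g1, γ (c • h) = c • γ h)
    -- satisfying the commutation rule `ρ⋆'(A)∘γ(h) − γ(h)∘ρ⋆(A) = γ(⁅A, h⁆)` :
    (hcomm : ∀ x ∈ g0, ∀ h ∈ g1, (ρU' x) ∘ₗ (γ h) - (γ h) ∘ₗ (ρU x) = γ ⁅x, h⁆) :
    -- conclusion : `C♭' ∘ γ(h) − γ(h) ∘ C♭ = 2 ∑ᵢ γ(εⁱ) ∘ ρ⋆(⁅h, eᵢ⁆)`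
    ∀ h ∈ g1,
      (-(2 : ℝ)⁻¹ • ρU' E + (2 * (d : ℝ))⁻¹ • (ρU' E ∘ₗ ρU' E)
          + ∑ j, ρU' (A j) ∘ₗ ρU' (As j)) ∘ₗ (γ h)
        - (γ h) ∘ₗ (-(2 : ℝ)⁻¹ • ρU E + (2 * (d : ℝ))⁻¹ • (ρU E ∘ₗ ρU E)
          + ∑ j, ρU (A j) ∘ₗ ρU (As j))
      = (2 : ℝ) • ∑ i, (γ (ε i)) ∘ₗ (ρU ⁅h, e i⁆) := by
  intro h hh
  rcases Nat.eq_zero_or_pos d with rfl | hd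
  · have hγ0 : γ 0 = 0 := by simpa using hγsmul 0 0 g1.zero_mem
    have h_zero : h = 0 := by
      rw [← hspan_ε] at hh
      simpa using hh
    simp [h_zero, hγ0]
  have hd0 : (d : ℝ) ≠ 0 := by positivity
  have hh0 : h0 ≤ g0 := hg0 ▸ le_sup_left
  have hA0 : ∀ j, A j ∈ g0 := fun j => hh0 (hA j)
  have hAs0 : ∀ j, As j ∈ g0 := fun j => hh0 (hAs j)
  -- Killing-orthogonality of graded pieces whose degrees are not opposite
  have wm : ∀ x ∈ gm, ⁅E, x⁆ = (-1 : ℝ) • x := fun x hx => by simp [hEm x hx]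
  have w0 : ∀ x ∈ g0, ⁅E, x⁆ = (0 : ℝ) • x := fun x hx => by simp [hE0 x hx]
  have w1 : ∀ x ∈ g1, ⁅E, x⁆ = (1 : ℝ) • x := fun x hx => by simp [hE1 x hx]
  have kmm : ∀ x ∈ gm, ∀ y ∈ gm, killingForm ℝ L x y = 0 := fun x hx y hy =>
    killingForm_eq_zero_of_eigen (wm x hx) (wm y hy) (by norm_num)
  have km0 : ∀ x ∈ gm, ∀ y ∈ g0, killingForm ℝ L x y = 0 := fun x hx y hy =>
    killingForm_eq_zero_of_eigen (wm x hx) (w0 y hy) (by norm_num)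
  have k0m : ∀ x ∈ g0, ∀ y ∈ gm, killingForm ℝ L x y = 0 := fun x hx y hy =>
    killingForm_eq_zero_of_eigen (w0 x hx) (wm y hy) (by norm_num)
  have k01 : ∀ x ∈ g0, ∀ y ∈ g1, killingForm ℝ L x y = 0 := fun x hx y hy =>
    killingForm_eq_zero_of_eigen (w0 x hx) (w1 y hy) (by norm_num)
  have k10 : ∀ x ∈ g1, ∀ y ∈ g0, killingForm ℝ L x y = 0 := fun x hx y hy =>
    killingForm_eq_zero_of_eigen (w1 x hx) (w0 y hy) (by norm_num)
  have k11 : ∀ x ∈ g1, ∀ y ∈ g1, killingForm ℝ L x y = 0 := fun x hx y hy =>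
    killingForm_eq_zero_of_eigen (w1 x hx) (w1 y hy) (by norm_num)
  -- expansions in the dual bases of the graded pieces
  have decm : ∀ y ∈ gm, ∑ i, killingForm ℝ L (ε i) y • e i = y := fun y hy =>
    sum_dual_smul_eq_of_mem_span _ e ε hdual_eε (hspan_e ▸ hy)
  have dec1 : ∀ y ∈ g1, ∑ i, killingForm ℝ L (e i) y • ε i = y := fun y hy =>
    sum_dual_smul_eq_of_mem_span _ ε e
      (fun i j => by rw [killingForm_symm, hdual_eε]; simp only [eq_comm]) (hspan_ε ▸ hy)
  have dec0_aux : ∀ B Bs : Fin n → L, (∀ j, killingForm ℝ L E (B j) = 0) →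
      (∀ j, killingForm ℝ L E (Bs j) = 0) → Submodule.span ℝ (Set.range B) = h0 →
      (∀ j k, killingForm ℝ L (Bs j) (B k) = if j = k then 1 else 0) →
      ∀ y ∈ g0, ((2 * (d : ℝ))⁻¹ * killingForm ℝ L E y) • E
        + ∑ j, killingForm ℝ L (Bs j) y • B j = y := by
    intro B Bs hB hBs hspan hdual y hy
    rw [hg0, Submodule.mem_sup] at hy
    obtain ⟨y', hy', z, hz, rfl⟩ := hy
    obtain ⟨c, rfl⟩ := Submodule.mem_span_singleton.mp hz
    rw [← hspan] at hy'
    have hEy : killingForm ℝ L E y' = 0 := by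
      rw [← sum_dual_smul_eq_of_mem_span _ B Bs hdual hy']
      simp [hB]
    have hc : (2 * (d : ℝ))⁻¹ * (c * (2 * d)) = c := by field_simp
    simp only [map_add, map_smul, hEy, hKEE, killingForm_symm (Bs _) E, hBs, smul_eq_mul, zero_add,
      mul_zero, add_zero, hc, sum_dual_smul_eq_of_mem_span _ B Bs hdual hy']
    exact add_comm _ _
  have dec0 := dec0_aux A As hKEA hKEAs hspan_A hdual_AAs
  have dec0' := dec0_aux As A hKEAs hKEA hspan_As
    (fun j k => by rw [killingForm_symm, hdual_AAs]; simp only [eq_comm])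
  -- the Killing-dual bases of the whole algebra
  let x : (Fin d ⊕ Fin d) ⊕ (Unit ⊕ Fin n) → L := Sum.elim (Sum.elim e ε) (Sum.elim (fun _ => E) A)
  let x' : (Fin d ⊕ Fin d) ⊕ (Unit ⊕ Fin n) → L :=
    Sum.elim (Sum.elim ε e) (Sum.elim (fun _ => (2 * (d : ℝ))⁻¹ • E) As)
  have hdec : ∀ y, ∑ i, killingForm ℝ L (x' i) y • x i = y := by
    intro y
    have hy : y ∈ gm ⊔ g0 ⊔ g1 := hsup ▸ Submodule.mem_top
    obtain ⟨y', hy', y₁, hy₁, rfl⟩ := Submodule.mem_sup.mp hy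
    obtain ⟨y₂, hy₂, y₀, hy₀, rfl⟩ := Submodule.mem_sup.mp hy'
    simp only [x, x', Fintype.sum_sum_type, Sum.elim_inl, Sum.elim_inr, map_add, map_smul,
      LinearMap.smul_apply, smul_eq_mul, Finset.univ_unique, Finset.sum_singleton,
      k10 _ (hε _) _ hy₀, k11 _ (hε _) _ hy₁, kmm _ (he _) _ hy₂, km0 _ (he _) _ hy₀,
      k0m _ hE _ hy₂, k01 _ hE _ hy₁, k0m _ (hAs0 _) _ hy₂, k01 _ (hAs0 _) _ hy₁,
      mul_zero, add_zero, zero_add, decm _ hy₂, dec1 _ hy₁, dec0 _ hy₀]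
    abel
  have hS : (2 : ℝ) • ∑ i, ⁅ε i, e i⁆ = E := by
    refine eq_of_killingForm_eq hdec fun z => ?_
    rw [killingForm_eq_sum hdec E z]
    simp only [← killingForm_lie_left _ E, ← lie_skew _ E]
    simp only [x, x', Fintype.sum_sum_type, Sum.elim_inl, Sum.elim_inr, lie_smul, lie_self,
      hE1 _ (hε _), hEm _ (he _), hE0 _ (hAs0 _), smul_zero, map_neg, map_zero, neg_neg,
      LinearMap.neg_apply, LinearMap.zero_apply, neg_zero, Finset.sum_const_zero, add_zero,
      map_smul, map_sum, LinearMap.smul_apply, LinearMap.sum_apply, smul_eq_mul]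
    rw [two_mul]
    congr 1 <;> refine Finset.sum_congr rfl fun i _ => ?_
    · rw [killingForm_lie_left, ← lie_skew (e i), map_neg]
    · rw [← lie_skew, map_neg, LinearMap.neg_apply, killingForm_lie_left,
        ← lie_skew z, map_neg]
  have hCas : ∑ j, ⁅A j, ⁅As j, h⁆⁆ = ((2 : ℝ)⁻¹ - (2 * (d : ℝ))⁻¹) • h := by
    have hC := casimir_ad_eq_id hdec h
    have hεe : ∑ i, ⁅ε i, ⁅e i, h⁆⁆ = (2 : ℝ)⁻¹ • h := by
      have : ∀ i, ⁅ε i, ⁅e i, h⁆⁆ = ⁅⁅ε i, e i⁆, h⁆ := fun i => by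
        rw [leibniz_lie, h11 _ (hε i) _ hh, lie_zero, add_zero]
      rw [Finset.sum_congr rfl fun i _ => this i, ← sum_lie, eq_inv_smul_iff₀ two_ne_zero,
        ← smul_lie, hS, hE1 h hh]
    simp only [x, x', Fintype.sum_sum_type, Sum.elim_inl, Sum.elim_inr, smul_lie, lie_smul,
      h11 _ (hε _) _ hh, lie_zero, Finset.sum_const_zero, zero_add, hεe, hE1 h hh,
      Finset.univ_unique, Finset.sum_singleton] at hC
    rw [eq_sub_of_add_eq' (eq_sub_of_add_eq' hC)]
    module
  -- linearity of `γ` on `g₁`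
  have hγ0 : γ 0 = 0 := by simpa using hγsmul 0 0 g1.zero_mem
  have hγsum : ∀ (m : ℕ) (f : Fin m → L), (∀ i, f i ∈ g1) → γ (∑ i, f i) = ∑ i, γ (f i) := by
    intro m f hf
    induction m with
    | zero => simpa using hγ0
    | succ m ih =>
      rw [Fin.sum_univ_succ, Fin.sum_univ_succ, hγadd _ (hf 0) _ (g1.sum_mem fun i _ => hf i.succ),
        ih _ fun i => hf i.succ]
  have hγε : ∀ y ∈ g1, γ y = ∑ i, killingForm ℝ L (e i) y • γ (ε i) := by
    intro y hy
    conv_lhs => rw [← dec1 y hy, hγsum _ _ fun i => g1.smul_mem _ (hε i)]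
    exact Finset.sum_congr rfl fun i _ => hγsmul _ _ (hε i)
  -- expansion of the right-hand side in a basis of `g₀`
  have hrhs : ∀ B Bs : Fin n → L, (∀ j, Bs j ∈ g0) →
      (∀ y ∈ g0, ((2 * (d : ℝ))⁻¹ * killingForm ℝ L E y) • E
        + ∑ j, killingForm ℝ L (Bs j) y • B j = y) → ∀ u,
      ∑ i, γ (ε i) (ρU ⁅h, e i⁆ u)
        = (2 * (d : ℝ))⁻¹ • γ h (ρU E u) + ∑ j, γ ⁅Bs j, h⁆ (ρU (B j) u) := by
    intro B Bs hBs hdecB u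
    have hE' : ∀ i, killingForm ℝ L E ⁅h, e i⁆ = killingForm ℝ L (e i) h := fun i => by
      rw [← killingForm_lie_left, hE1 h hh, killingForm_symm]
    have hB' : ∀ i j, killingForm ℝ L (Bs j) ⁅h, e i⁆ = killingForm ℝ L (e i) ⁅Bs j, h⁆ :=
      fun i j => by rw [← killingForm_lie_left, killingForm_symm]
    have hmem : ∀ i, ⁅h, e i⁆ ∈ g0 := fun i => by
      rw [← lie_skew]
      exact g0.neg_mem (hm1 _ (he i) _ hh)
    have hexp : ∀ i, γ (ε i) (ρU ⁅h, e i⁆ u)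
        = (2 * (d : ℝ))⁻¹ • killingForm ℝ L (e i) h • γ (ε i) (ρU E u)
          + ∑ j, killingForm ℝ L (e i) ⁅Bs j, h⁆ • γ (ε i) (ρU (B j) u) := fun i => by
      conv_lhs => rw [← hdecB _ (hmem i)]
      simp only [hE', hB', map_add, map_smul, map_sum, LinearMap.add_apply, LinearMap.smul_apply,
        LinearMap.sum_apply, mul_smul]
    simp only [hexp, Finset.sum_add_distrib, ← Finset.smul_sum]
    rw [Finset.sum_comm, hγε h hh]
    simp only [hγε _ (h01 _ (hBs _) _ hh), LinearMap.sum_apply, LinearMap.smul_apply]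
  have hc : ∀ x ∈ g0, ∀ y ∈ g1, ∀ u, ρU' x (γ y u) = γ y (ρU x u) + γ ⁅x, y⁆ u :=
    fun x hx y hy u => by
      rw [← hcomm x hx y hy]
      simp
  ext u
  have hZ : ∑ j, γ ⁅A j, ⁅As j, h⁆⁆ u = ((2 : ℝ)⁻¹ - (2 * (d : ℝ))⁻¹) • γ h u := by
    rw [← LinearMap.smul_apply, ← hγsmul _ _ hh, ← hCas,
      hγsum _ _ fun j => h01 _ (hA0 j) _ (h01 _ (hAs0 j) _ hh), LinearMap.sum_apply]
  have hR := hrhs A As hAs0 dec0 u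
  have hR' := hrhs As A hA0 dec0' u
  simp only [LinearMap.sub_apply, LinearMap.comp_apply, LinearMap.add_apply, LinearMap.smul_apply,
    LinearMap.sum_apply, map_add, map_smul, map_sum, hc E hE h hh, hE1 h hh,
    hc _ (hAs0 _) h hh, hc _ (hA0 _) h hh, hc _ (hA0 _) _ (h01 _ (hAs0 _) _ hh),
    Finset.sum_add_distrib, hZ]
  rw [two_smul ℝ (∑ i, _)]
  nth_rewrite 1 [hR]
  rw [hR']
  module
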